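/- Assume in addition that ρ > 4λ‖A⁻¹‖, and let S ⊆ ℝ^N × ℝ^N × ℝ^N be the set of subsequential limits of the sequence ((α^k, c^k, γ^k))_{k≥1}. Then there exists a real number L* such that L_ρ(α*, c*, γ*) = L* for every (α*, c*, γ*) ∈ S, and the sequence (L_ρ(α^k, c^k, γ^k))_{k≥1} converges to L*. -/

import Mathlib

open Matrix

/-- The Euclidean (2-)norm on `ℝ^N`. -/
noncomputable def euclNorm {N : ℕ} (v : Fin N → ℝ) : ℝ :=
  Real.sqrt (∑ i, v i ^ 2)

/-- The operator 2-norm of an `N × N` real matrix (as an operator on Euclidean space). -/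
noncomputable def opNorm2 {N : ℕ} (M : Matrix (Fin N) (Fin N) ℝ) : ℝ :=
  ‖(Matrix.toEuclideanLin M).toContinuousLinearMap‖

/-- The augmented Lagrangian
`L_ρ(α, c, γ) = F(α) + λcᵀAc + γᵀ(α − Ac) + (ρ/2)‖α − Ac‖²`. -/
noncomputable def augLag {N : ℕ} (F : (Fin N → ℝ) → ℝ) (A : Matrix (Fin N) (Fin N) ℝ)
    (lam ρ : ℝ) (a c g : Fin N → ℝ) : ℝ :=
  F a + lam * (c ⬝ᵥ A.mulVec c) + g ⬝ᵥ (a - A.mulVec c) +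
    ρ / 2 * euclNorm (a - A.mulVec c) ^ 2

open Filter Topology

theorem euclNorm_sq {N : ℕ} (v : Fin N → ℝ) : euclNorm v ^ 2 = v ⬝ᵥ v := by
  rw [euclNorm, Real.sq_sqrt (Finset.sum_nonneg fun i _ => sq_nonneg _)]
  simp [dotProduct, sq]

theorem augLag_eq {N : ℕ} (F : (Fin N → ℝ) → ℝ) (A : Matrix (Fin N) (Fin N) ℝ)
    (lam ρ : ℝ) (a c g : Fin N → ℝ) :
    augLag F A lam ρ a c g = F a + (lam * (c ⬝ᵥ A *ᵥ c) + g ⬝ᵥ (a - A *ᵥ c) +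
      ρ / 2 * ((a - A *ᵥ c) ⬝ᵥ (a - A *ᵥ c))) := by
  rw [augLag, euclNorm_sq]
  ring

theorem opNorm2_nonneg {N : ℕ} (M : Matrix (Fin N) (Fin N) ℝ) : 0 ≤ opNorm2 M :=
  norm_nonneg _

theorem euclNorm_eq_norm {N : ℕ} (v : Fin N → ℝ) : euclNorm v = ‖WithLp.toLp 2 v‖ := by
  simp [euclNorm, EuclideanSpace.norm_eq]

theorem euclNorm_mulVec_le {N : ℕ} (M : Matrix (Fin N) (Fin N) ℝ) (v : Fin N → ℝ) :
    euclNorm (M *ᵥ v) ≤ opNorm2 M * euclNorm v := by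
  rw [euclNorm_eq_norm, euclNorm_eq_norm]
  simpa [opNorm2] using
    (Matrix.toEuclideanLin M).toContinuousLinearMap.le_opNorm (WithLp.toLp 2 v)

theorem mulVec_dotProduct_self_le {N : ℕ} (M : Matrix (Fin N) (Fin N) ℝ) (v : Fin N → ℝ) :
    (M *ᵥ v) ⬝ᵥ (M *ᵥ v) ≤ opNorm2 M ^ 2 * (v ⬝ᵥ v) := by
  rw [← euclNorm_sq, ← euclNorm_sq, ← mul_pow]
  exact pow_le_pow_left₀ (Real.sqrt_nonneg _) (euclNorm_mulVec_le M v) 2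

theorem dotProduct_mulVec_le {N : ℕ} (M : Matrix (Fin N) (Fin N) ℝ) (v : Fin N → ℝ) :
    v ⬝ᵥ M *ᵥ v ≤ opNorm2 M * (v ⬝ᵥ v) := by
  have h : v ⬝ᵥ M *ᵥ v ≤ euclNorm v * euclNorm (M *ᵥ v) := by
    rw [euclNorm_eq_norm, euclNorm_eq_norm]
    simpa [EuclideanSpace.inner_eq_star_dotProduct, dotProduct_comm] using
      real_inner_le_norm (WithLp.toLp 2 v) (WithLp.toLp 2 (M *ᵥ v))
  rw [← euclNorm_sq]
  nlinarith [mul_le_mul_of_nonneg_left (euclNorm_mulVec_le M v)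
    (show 0 ≤ euclNorm v from Real.sqrt_nonneg _)]

theorem Matrix.IsSymm.dotProduct_mulVec_comm {N : ℕ} {A : Matrix (Fin N) (Fin N) ℝ}
    (hA : A.IsSymm) (x y : Fin N → ℝ) : x ⬝ᵥ A *ᵥ y = y ⬝ᵥ A *ᵥ x := by
  rw [dotProduct_mulVec, ← mulVec_transpose, hA.eq, dotProduct_comm]

/-- Exact second-order expansion of the augmented Lagrangian in its second argument. -/
theorem augLag_add {N : ℕ} (F : (Fin N → ℝ) → ℝ) {A : Matrix (Fin N) (Fin N) ℝ}
    (hA : A.IsSymm) (lam ρ : ℝ) (a c g e : Fin N → ℝ) :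
    augLag F A lam ρ a (c + e) g = augLag F A lam ρ a c g
      + ((2 * lam) • c - (g + ρ • (a - A *ᵥ c))) ⬝ᵥ A *ᵥ e
      + (lam * (e ⬝ᵥ A *ᵥ e) + ρ / 2 * ((A *ᵥ e) ⬝ᵥ (A *ᵥ e))) := by
  rw [augLag_eq, augLag_eq]
  simp only [mulVec_add, dotProduct_add, add_dotProduct, sub_dotProduct, dotProduct_sub,
    smul_dotProduct, smul_eq_mul, hA.dotProduct_mulVec_comm e c,
    dotProduct_comm (A *ᵥ e) a, dotProduct_comm (A *ᵥ e) (A *ᵥ c), dotProduct_comm (A *ᵥ c) a]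
  ring

theorem nonpos_of_forall_mul_le_sq_mul {s K : ℝ} (h : ∀ t : ℝ, t * s ≤ t ^ 2 * K) : s ≤ 0 := by
  by_contra! hs
  have hK : 0 < |K| + 1 := by positivity
  have h1 := h (s / (2 * (|K| + 1)))
  have h2 : s / (2 * (|K| + 1)) * s = s ^ 2 / (2 * (|K| + 1)) := by ring
  have h3 : (s / (2 * (|K| + 1))) ^ 2 * K ≤ s ^ 2 / (4 * (|K| + 1)) := by
    calc (s / (2 * (|K| + 1))) ^ 2 * K ≤ (s / (2 * (|K| + 1))) ^ 2 * (|K| + 1) := by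
          gcongr; linarith [le_abs_self K]
      _ = _ := by field_simp; ring
  have h4 : s ^ 2 / (4 * (|K| + 1)) < s ^ 2 / (2 * (|K| + 1)) := by gcongr; norm_num
  linarith

/-- First-order optimality in the second argument. -/
theorem eq_of_forall_augLag_le {N : ℕ} {F : (Fin N → ℝ) → ℝ} {A : Matrix (Fin N) (Fin N) ℝ}
    (hAsymm : A.IsSymm) (hA : A.PosDef) {lam ρ : ℝ} {a c g : Fin N → ℝ}
    (h : ∀ b, augLag F A lam ρ a c g ≤ augLag F A lam ρ a b g) :
    g + ρ • (a - A *ᵥ c) = (2 * lam) • c := by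
  set w := (2 * lam) • c - (g + ρ • (a - A *ᵥ c)) with hw
  suffices hw0 : w = 0 from (sub_eq_zero.mp (hw ▸ hw0)).symm
  have key : w ⬝ᵥ A *ᵥ w ≤ 0 := by
    refine nonpos_of_forall_mul_le_sq_mul
      (K := lam * (w ⬝ᵥ A *ᵥ w) + ρ / 2 * ((A *ᵥ w) ⬝ᵥ (A *ᵥ w))) fun t => ?_
    have h1 := h (c + (-t) • w)
    rw [augLag_add F hAsymm, ← hw] at h1
    simp only [mulVec_smul, dotProduct_smul, smul_dotProduct, smul_eq_mul] at h1
    linarith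
  by_contra hne
  have := hA.dotProduct_mulVec_pos hne
  simp only [star_trivial] at this
  linarith

/-- Nonnegativity of the augmented Lagrangian when the multiplier is `2λc`. -/
theorem augLag_nonneg {N : ℕ} {F : (Fin N → ℝ) → ℝ} {A : Matrix (Fin N) (Fin N) ℝ}
    (hAsymm : A.IsSymm) (hA : A.PosDef) {lam ρ : ℝ} (hlam : 0 < lam)
    (hρ : 2 * lam * opNorm2 A⁻¹ ≤ ρ) {a : Fin N → ℝ} (hF : 0 ≤ F a) (c : Fin N → ℝ) :
    0 ≤ augLag F A lam ρ a c ((2 * lam) • c) := by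
  rw [augLag_eq]
  set r := a - A *ᵥ c
  have hinv : A *ᵥ (A⁻¹ *ᵥ r) = r := by
    rw [mulVec_mulVec, mul_nonsing_inv _ ((isUnit_iff_isUnit_det A).mp hA.isUnit), one_mulVec]
  have h1 := hA.posSemidef.dotProduct_mulVec_nonneg (c + A⁻¹ *ᵥ r)
  simp only [star_trivial, mulVec_add, hinv, dotProduct_add, add_dotProduct,
    hAsymm.dotProduct_mulVec_comm (A⁻¹ *ᵥ r) c, dotProduct_comm (A⁻¹ *ᵥ r) r] at h1
  have h2 := dotProduct_mulVec_le A⁻¹ r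
  have h3 : 0 ≤ r ⬝ᵥ r := by rw [← euclNorm_sq]; positivity
  rw [smul_dotProduct, smul_eq_mul]
  nlinarith [mul_le_mul_of_nonneg_right hρ h3]

/-- Sufficient decrease over one ADMM step whose initial multiplier is `2λc`. -/
theorem augLag_sufficient_decrease {N : ℕ} {F : (Fin N → ℝ) → ℝ} {A : Matrix (Fin N) (Fin N) ℝ}
    (hAsymm : A.IsSymm) (hA : A.PosDef) {lam ρ : ℝ} (hlam : 0 < lam) (hρ : 0 < ρ)
    (hρbig : 4 * lam * opNorm2 A⁻¹ < ρ) {a a' c c' : Fin N → ℝ}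
    (ha : augLag F A lam ρ a' c ((2 * lam) • c) ≤ augLag F A lam ρ a c ((2 * lam) • c))
    (hc : (2 * lam) • c + ρ • (a' - A *ᵥ c') = (2 * lam) • c') :
    augLag F A lam ρ a' c' ((2 * lam) • c') + 4 * lam ^ 2 / ρ * ((c' - c) ⬝ᵥ (c' - c)) ≤
      augLag F A lam ρ a c ((2 * lam) • c) := by
  set d := c' - c with hd
  have hr : a' - A *ᵥ c' = (2 * lam / ρ) • d := by
    have : ρ • (a' - A *ᵥ c') = (2 * lam) • d := by
      rw [hd, smul_sub (2 * lam), ← hc, add_sub_cancel_left]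
    rw [div_eq_inv_mul, mul_smul, ← this, smul_smul, inv_mul_cancel₀ hρ.ne', one_smul]
  have hmult : augLag F A lam ρ a' c' ((2 * lam) • c') =
      augLag F A lam ρ a' c' ((2 * lam) • c) + 4 * lam ^ 2 / ρ * (d ⬝ᵥ d) := by
    have hc' : c' = c + d := by rw [hd]; abel
    rw [augLag_eq, augLag_eq, hr]
    nth_rewrite 3 [hc']
    simp only [smul_add, add_dotProduct, smul_dotProduct, dotProduct_smul, smul_eq_mul]
    ring
  have hquad := augLag_add F hAsymm lam ρ a' c' ((2 * lam) • c) (-d)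
  rw [hc, sub_self, zero_dotProduct, show c' + -d = c by rw [hd]; abel] at hquad
  simp only [mulVec_neg, neg_dotProduct, dotProduct_neg, neg_neg] at hquad
  have hpos := hA.posSemidef.dotProduct_mulVec_nonneg d
  simp only [star_trivial] at hpos
  have hbound := mulVec_dotProduct_self_le A⁻¹ (A *ᵥ d)
  rw [mulVec_mulVec, nonsing_inv_mul _ ((isUnit_iff_isUnit_det A).mp hA.isUnit),
    one_mulVec] at hbound
  set u := (A *ᵥ d) ⬝ᵥ (A *ᵥ d) with hu
  have hu0 : 0 ≤ u := by rw [hu, ← euclNorm_sq]; positivity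
  have hsq : (4 * lam * opNorm2 A⁻¹) ^ 2 ≤ ρ ^ 2 :=
    pow_le_pow_left₀ (mul_nonneg (by positivity) (opNorm2_nonneg _)) hρbig.le 2
  have hmain : 8 * lam ^ 2 / ρ * (d ⬝ᵥ d) ≤ ρ / 2 * u := by
    rw [div_mul_eq_mul_div, div_le_iff₀ hρ]
    nlinarith [mul_le_mul_of_nonneg_right hsq hu0,
      mul_le_mul_of_nonneg_left hbound (sq_nonneg lam)]
  have hsplit : 8 * lam ^ 2 / ρ * (d ⬝ᵥ d) = 2 * (4 * lam ^ 2 / ρ * (d ⬝ᵥ d)) := by ring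
  nlinarith [mul_nonneg hlam.le hpos]

theorem tendsto_zero_of_dotProduct_self {N : ℕ} {ι : Type*} {l : Filter ι} {v : ι → Fin N → ℝ}
    (h : Tendsto (fun k => v k ⬝ᵥ v k) l (𝓝 0)) : Tendsto v l (𝓝 0) := by
  rw [tendsto_pi_nhds]
  intro i
  have hsq : Tendsto (fun k => v k i ^ 2) l (𝓝 0) := by
    refine squeeze_zero (fun k => sq_nonneg _) (fun k => ?_) h
    rw [dotProduct, sq]
    exact Finset.single_le_sum (f := fun j => v k j * v k j)
      (fun j _ => mul_self_nonneg _) (Finset.mem_univ i)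
  have habs := hsq.sqrt
  simp only [Real.sqrt_sq_eq_abs, Real.sqrt_zero] at habs
  exact tendsto_zero_iff_abs_tendsto_zero _ |>.mpr habs

theorem tendsto_zero_of_add_mul_le {u s : ℕ → ℝ} {κ : ℝ} (hκ : 0 < κ) (hu : ∀ k, 0 ≤ u k)
    (hs : ∀ k, 0 ≤ s k) (h : ∀ k, u (k + 1) + κ * s k ≤ u k) :
    (∃ L, Tendsto u atTop (𝓝 L)) ∧ Tendsto s atTop (𝓝 0) := by
  have hanti : Antitone u := antitone_nat_of_succ_le fun k => by
    linarith [h k, mul_nonneg hκ.le (hs k)]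
  have hL := tendsto_atTop_ciInf hanti ⟨0, by rintro _ ⟨k, rfl⟩; exact hu k⟩
  refine ⟨⟨_, hL⟩, ?_⟩
  have hdiff : Tendsto (fun k => κ⁻¹ * (u k - u (k + 1))) atTop (𝓝 0) := by
    simpa using (hL.sub (hL.comp (tendsto_add_atTop_nat 1))).const_mul κ⁻¹
  refine squeeze_zero hs (fun k => ?_) hdiff
  rw [← div_eq_inv_mul, le_div_iff₀ hκ]
  linarith [h k]

/-- The continuous part `augLag F - F` converges along convergent sequences. -/
theorem tendsto_augLag_sub {N : ℕ} {ι : Type*} {l : Filter ι} (F : (Fin N → ℝ) → ℝ)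
    (A : Matrix (Fin N) (Fin N) ℝ) (lam ρ : ℝ) {a c g : ι → Fin N → ℝ} {a₀ c₀ g₀ : Fin N → ℝ}
    (ha : Tendsto a l (𝓝 a₀)) (hc : Tendsto c l (𝓝 c₀)) (hg : Tendsto g l (𝓝 g₀)) :
    Tendsto (fun k => augLag F A lam ρ (a k) (c k) (g k) - F (a k)) l
      (𝓝 (augLag F A lam ρ a₀ c₀ g₀ - F a₀)) := by
  simp only [augLag_eq, add_sub_cancel_left]
  have hcont : Continuous fun p : (Fin N → ℝ) × (Fin N → ℝ) × (Fin N → ℝ) =>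
      lam * (p.2.1 ⬝ᵥ A *ᵥ p.2.1) + p.2.2 ⬝ᵥ (p.1 - A *ᵥ p.2.1) +
        ρ / 2 * ((p.1 - A *ᵥ p.2.1) ⬝ᵥ (p.1 - A *ᵥ p.2.1)) := by
    fun_prop
  have hlim : Tendsto (fun k => (a k, c k, g k)) l (𝓝 (a₀, c₀, g₀)) :=
    ha.prodMk_nhds (hc.prodMk_nhds hg)
  have := (hcont.tendsto (a₀, c₀, g₀)).comp hlim
  simpa only [Function.comp_def] using this

/-- Along minimizers `a k` of `augLag · (c' k) (g' k)` the value of the augmented Lagrangian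
passes to the limit, although `F` is only lower semicontinuous. -/
theorem augLag_eq_of_tendsto {N : ℕ} {ι : Type*} {l : Filter ι} [l.NeBot]
    {F : (Fin N → ℝ) → ℝ} (hF : LowerSemicontinuous F) {A : Matrix (Fin N) (Fin N) ℝ}
    {lam ρ L : ℝ} {a c c' g g' : ι → Fin N → ℝ} {a₀ c₀ g₀ : Fin N → ℝ}
    (ha : Tendsto a l (𝓝 a₀)) (hc : Tendsto c l (𝓝 c₀)) (hg : Tendsto g l (𝓝 g₀))
    (hc' : Tendsto c' l (𝓝 c₀)) (hg' : Tendsto g' l (𝓝 g₀))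
    (hmin : ∀ᶠ k in l,
      augLag F A lam ρ (a k) (c' k) (g' k) ≤ augLag F A lam ρ a₀ (c' k) (g' k))
    (hL : Tendsto (fun k => augLag F A lam ρ (a k) (c k) (g k)) l (𝓝 L)) :
    augLag F A lam ρ a₀ c₀ g₀ = L := by
  have hFa : Tendsto (fun k => F (a k)) l (𝓝 (L - (augLag F A lam ρ a₀ c₀ g₀ - F a₀))) := by
    simpa using hL.sub (tendsto_augLag_sub F A lam ρ ha hc hg)
  apply le_antisymm
  · have : F a₀ ≤ L - (augLag F A lam ρ a₀ c₀ g₀ - F a₀) := by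
      refine le_of_forall_lt fun y hy => ?_
      obtain ⟨z, hyz, hz⟩ := exists_between hy
      exact hyz.trans_le (ge_of_tendsto hFa ((ha.eventually (hF a₀ z hz)).mono fun _ h => h.le))
    linarith
  · have h1 := (tendsto_augLag_sub F A lam ρ ha hc' hg').add hFa
    have h2 := (tendsto_augLag_sub F A lam ρ (tendsto_const_nhds (x := a₀)) hc' hg').add
      (tendsto_const_nhds (x := F a₀))
    have := le_of_tendsto_of_tendsto h1 h2 (hmin.mono fun k hk => by simpa using hk)
    linarith

/-- **Lemma 4.3**: if `ρ > 4λ‖A⁻¹‖`, then the augmented Lagrangian is constant on the set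
`S` of subsequential limits of `((α^k, c^k, γ^k))_{k≥1}`, and
`(L_ρ(α^k, c^k, γ^k))_{k≥1}` converges to that constant value. -/
theorem admm_lagrangian_constant_on_limit_set
    (N : ℕ) (hN : 0 < N) (A : Matrix (Fin N) (Fin N) ℝ)
    (hAsymm : A.IsSymm) (hA : A.PosDef)
    (lam ρ : ℝ) (hlam : 0 < lam) (hρ : 0 < ρ)
    (F : (Fin N → ℝ) → ℝ) (hF0 : ∀ v, 0 ≤ F v) (hFlsc : LowerSemicontinuous F)
    (α c γ : ℕ → Fin N → ℝ)
    (hα : ∀ k, ∀ a : Fin N → ℝ,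
      augLag F A lam ρ (α (k+1)) (c k) (γ k) ≤ augLag F A lam ρ a (c k) (γ k))
    (hc : ∀ k, ∀ b : Fin N → ℝ,
      augLag F A lam ρ (α (k+1)) (c (k+1)) (γ k) ≤ augLag F A lam ρ (α (k+1)) b (γ k))
    (hγ : ∀ k, γ (k+1) = γ k + ρ • (α (k+1) - A.mulVec (c (k+1))))
    (hρbig : 4 * lam * opNorm2 A⁻¹ < ρ)
    (S : Set ((Fin N → ℝ) × (Fin N → ℝ) × (Fin N → ℝ)))
    (hS : S = {p | ∃ φ : ℕ → ℕ, StrictMono φ ∧ (∀ n, 1 ≤ φ n) ∧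
      Filter.Tendsto (fun n => (α (φ n), c (φ n), γ (φ n)))
        Filter.atTop (nhds p)}) :
    ∃ Lstar : ℝ,
      (∀ p ∈ S, augLag F A lam ρ p.1 p.2.1 p.2.2 = Lstar) ∧
      Filter.Tendsto (fun k => augLag F A lam ρ (α k) (c k) (γ k))
        Filter.atTop (nhds Lstar) := by
  have hmul : ∀ k, γ (k + 1) = (2 * lam) • c (k + 1) := fun k => by
    rw [hγ k]
    exact eq_of_forall_augLag_le hAsymm hA (hc k)
  have hρ' : 2 * lam * opNorm2 A⁻¹ ≤ ρ := by
    nlinarith [mul_nonneg hlam.le (opNorm2_nonneg A⁻¹)]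
  obtain ⟨⟨L, hL⟩, hd⟩ := tendsto_zero_of_add_mul_le
    (u := fun k => augLag F A lam ρ (α (k + 1)) (c (k + 1)) (γ (k + 1)))
    (s := fun k => (c (k + 2) - c (k + 1)) ⬝ᵥ (c (k + 2) - c (k + 1)))
    (κ := 4 * lam ^ 2 / ρ) (by positivity)
    (fun k => by
      simp only [hmul k]
      exact augLag_nonneg hAsymm hA hlam hρ' (hF0 _) _)
    (fun k => by rw [← euclNorm_sq]; positivity)
    (fun k => by
      simp only [hmul k, hmul (k + 1)]
      refine augLag_sufficient_decrease hAsymm hA hlam hρ hρbig ?_ ?_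
      · rw [← hmul k]
        exact hα (k + 1) _
      · rw [← hmul k, ← hmul (k + 1), hγ (k + 1)])
  have hL' : Tendsto (fun k => augLag F A lam ρ (α k) (c k) (γ k)) atTop (𝓝 L) :=
    (tendsto_add_atTop_iff_nat 1).mp hL
  refine ⟨L, ?_, hL'⟩
  subst hS
  rintro ⟨a₀, c₀, g₀⟩ ⟨φ, hφ, -, hlim⟩
  have ha : Tendsto (fun n => α (φ n)) atTop (𝓝 a₀) := hlim.fst_nhds
  have hcl : Tendsto (fun n => c (φ n)) atTop (𝓝 c₀) := hlim.snd_nhds.fst_nhds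
  have hg : Tendsto (fun n => γ (φ n)) atTop (𝓝 g₀) := hlim.snd_nhds.snd_nhds
  have hdc : Tendsto (fun k => c (k + 1) - c k) atTop (𝓝 0) :=
    (tendsto_add_atTop_iff_nat 1).mp (tendsto_zero_of_dotProduct_self hd)
  have htwo : ∀ᶠ n in atTop, 2 ≤ φ n := hφ.tendsto_atTop.eventually_ge_atTop 2
  have hpred : Tendsto (fun n => φ n - 1) atTop atTop :=
    (tendsto_sub_atTop_nat 1).comp hφ.tendsto_atTop
  have hc' : Tendsto (fun n => c (φ n - 1)) atTop (𝓝 c₀) := by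
    have h := hcl.sub (hdc.comp hpred)
    rw [sub_zero] at h
    refine h.congr' (htwo.mono fun n hn => ?_)
    simp [Nat.sub_add_cancel (show 1 ≤ φ n by omega)]
  have hg₀ : g₀ = (2 * lam) • c₀ := by
    refine tendsto_nhds_unique hg ((hcl.const_smul (2 * lam)).congr' (htwo.mono fun n hn => ?_))
    obtain ⟨m, hm⟩ := Nat.exists_eq_add_of_le' hn
    simp only [hm]
    exact (hmul (m + 1)).symm
  have hg' : Tendsto (fun n => γ (φ n - 1)) atTop (𝓝 g₀) := by
    rw [hg₀]
    refine (hc'.const_smul (2 * lam)).congr' (htwo.mono fun n hn => ?_)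
    obtain ⟨m, hm⟩ := Nat.exists_eq_add_of_le' hn
    simp only [hm]
    exact (hmul m).symm
  refine augLag_eq_of_tendsto hFlsc ha hcl hg hc' hg' (htwo.mono fun n hn => ?_)
    (hL'.comp hφ.tendsto_atTop)
  obtain ⟨m, hm⟩ := Nat.exists_eq_add_of_le' hn
  simp only [hm]
  exact hα (m + 1) a₀
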